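/- Let n ≥ 1, 1 < β ≤ 3/2, and C ≥ e^{β/n}. Define k(r) = 1/(r^n (log(C/r))^β) for 0 < r ≤ 1 and k(r) = 0 for r > 1, and set K(Q) = k(r_Q) for Q ∈ 𝒟. Let σ be Lebesgue measure on ℝ^n, let Q₀ = [0,1)^n be the unit cube, and let μ be Lebesgue measure restricted to Q₀. Then for p = 2 (so p' = 2): (i) the dyadic energy ℰ^𝒟_{K,σ}[μ] = ∫_{ℝ^n} (∑_{Q∈𝒟} K(Q) μ(Q) χ_Q(x))² dx is finite; but (ii) ∫_{ℝ^n} 𝒲̄^𝒟_{K,σ}[μ](x) dμ(x) = +∞, where 𝒲̄^𝒟_{K,σ}[μ](x) = ∑_{Q∈𝒟} σ(Q) K̄(Q)(x) ∫_Q K̄(Q)(y) dμ(y). -/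

import Mathlib

open MeasureTheory ENNReal Set
open scoped Classical ENNReal NNReal

noncomputable section

/-- We model `ℝ^n` as `EuclideanSpace ℝ (Fin n)`. -/
abbrev Euc (n : ℕ) := EuclideanSpace ℝ (Fin n)

/-- Indices `(k, m)` of dyadic cubes in `ℝ^n`. -/
abbrev DIdx (n : ℕ) := ℤ × (Fin n → ℤ)

/-- The dyadic cube with index `q = (k, m)`, namely `2^{-k}(m + [0,1)^n)`. -/
def dCube (n : ℕ) (q : DIdx n) : Set (Euc n) :=
  {x | ∀ i, (q.2 i : ℝ) ≤ (2:ℝ) ^ q.1 * x i ∧ (2:ℝ) ^ q.1 * x i < (q.2 i : ℝ) + 1}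

/-- The side length of the dyadic cube of index `q = (k, m)` is `2^{-k}`. -/
def sideLen (n : ℕ) (q : DIdx n) : ℝ := (2:ℝ) ^ (-q.1)

/-- Characteristic function of a dyadic cube, with values in `ℝ≥0∞`. -/
def ch (n : ℕ) (q : DIdx n) (x : Euc n) : ℝ≥0∞ := (dCube n q).indicator 1 x

/-- `K̄(Q)(x) = σ(Q)⁻¹ ∑_{Q' ⊆ Q} K(Q') σ(Q') χ_{Q'}(x)`.
(Since `σ(Q') ≤ σ(Q)` for `Q' ⊆ Q`, this is automatically `0` when `σ(Q) = 0`,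
by the convention `∞ · 0 = 0` in `ℝ≥0∞`.) -/
def Kbar (n : ℕ) (σ : Measure (Euc n)) (K : DIdx n → ℝ≥0∞) (q : DIdx n) (x : Euc n) : ℝ≥0∞ :=
  (σ (dCube n q))⁻¹ *
    ∑' q' : DIdx n, if dCube n q' ⊆ dCube n q then K q' * σ (dCube n q') * ch n q' x else 0

/-- The kernel `k(r) = 1/(r^n log^β(C/r))` for `0 < r ≤ 1` and `k(r) = 0` for `r > 1`,
evaluated on side lengths of dyadic cubes: `K(Q) = k(r_Q)`. -/
def logRieszK (n : ℕ) (β C : ℝ) (q : DIdx n) : ℝ≥0∞ :=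
  ENNReal.ofReal
    (if sideLen n q ≤ 1 then ((sideLen n q) ^ n * (Real.log (C / sideLen n q)) ^ β)⁻¹ else 0)

/-- The unit cube `Q₀ = [0,1)^n` as a dyadic cube. -/
def unitIdx (n : ℕ) : DIdx n := ((0:ℤ), fun _ => (0:ℤ))

/-- Index of the dyadic cube of level `k` containing `x`. -/
def idxAt (n : ℕ) (x : Euc n) (k : ℤ) : DIdx n := (k, fun i => ⌊(2:ℝ) ^ k * x i⌋)

lemma mem_dCube_iff (n : ℕ) (x : Euc n) (k : ℤ) (m : Fin n → ℤ) :
    x ∈ dCube n (k, m) ↔ (k, m) = idxAt n x k := by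
  simp only [dCube, idxAt, mem_ofPred_eq, Prod.mk.injEq, true_and]
  rw [funext_iff]
  refine forall_congr' fun i => ?_
  rw [eq_comm, Int.floor_eq_iff]

lemma mem_idxAt (n : ℕ) (x : Euc n) (k : ℤ) : x ∈ dCube n (idxAt n x k) :=
  (mem_dCube_iff n x k _).2 rfl

lemma idxAt_subset (n : ℕ) (x : Euc n) (k : ℤ) (d : ℕ) :
    dCube n (idxAt n x (k + d)) ⊆ dCube n (idxAt n x k) := by
  intro y hy
  have h1 := (mem_dCube_iff n y (k + d) _).1 hy
  refine (mem_dCube_iff n y k _).2 ?_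
  have h2 := congrArg Prod.snd h1
  simp only [idxAt, Prod.mk.injEq, true_and] at h2 ⊢
  funext i
  have h3 := congrFun h2 i
  have key : ∀ z : ℝ, ⌊(2:ℝ) ^ k * z⌋ = ⌊(2:ℝ) ^ (k + d : ℤ) * z⌋ / ((2 ^ d : ℕ) : ℤ) := by
    intro z
    have := Int.floor_div_natCast ((2:ℝ) ^ (k + d : ℤ) * z) (2 ^ d)
    rw [← this]
    congr 1
    rw [zpow_add₀ (by norm_num)]
    push_cast
    rw [zpow_natCast]
    field_simp
  rw [key, key, h3]

lemma volume_dCube (n : ℕ) (k : ℤ) (m : Fin n → ℤ) :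
    volume (dCube n (k, m)) = ENNReal.ofReal (((2:ℝ) ^ (-k)) ^ n) := by
  have h2 : (0:ℝ) < 2 ^ k := by positivity
  have h : dCube n (k, m) = (MeasurableEquiv.toLp 2 (Fin n → ℝ)).symm ⁻¹'
      (Set.pi univ fun i => Ico ((m i : ℝ) * 2 ^ (-k)) (((m i : ℝ) + 1) * 2 ^ (-k))) := by
    ext x
    simp only [dCube, mem_ofPred_eq, mem_preimage, mem_pi, mem_univ, true_implies, mem_Ico]
    refine forall_congr' fun i => ?_
    rw [zpow_neg, ← div_eq_mul_inv, ← div_eq_mul_inv, div_le_iff₀ h2, lt_div_iff₀ h2, mul_comm]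
    rfl
  rw [h, (EuclideanSpace.volume_preserving_symm_measurableEquiv_toLp (Fin n)).measure_preimage_equiv,
    Real.volume_pi_Ico]
  have : ∀ i, ((m i : ℝ) + 1) * 2 ^ (-k) - (m i : ℝ) * 2 ^ (-k) = 2 ^ (-k) := fun i => by ring
  simp only [this, Finset.prod_const, Finset.card_univ, Fintype.card_fin]
  rw [ENNReal.ofReal_pow (by positivity)]

lemma measurableSet_dCube (n : ℕ) (q : DIdx n) : MeasurableSet (dCube n q) := by
  unfold dCube
  measurability

/-- The values `K(Q)|Q|` at level `j`. -/
def aSeq (β C : ℝ) (j : ℕ) : ℝ := ((Real.log C + j * Real.log 2) ^ β)⁻¹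

lemma K_mul_vol (n : ℕ) (β C : ℝ) (hC : 0 < C) (j : ℕ) (m : Fin n → ℤ) :
    logRieszK n β C ((j : ℤ), m) * volume (dCube n ((j : ℤ), m)) = ENNReal.ofReal (aSeq β C j) := by
  have hr : (0:ℝ) < 2 ^ (-(j:ℤ)) := by positivity
  have h1 : (2:ℝ) ^ (-(j:ℤ)) ≤ 1 := by
    rw [zpow_neg, zpow_natCast]
    exact inv_le_one_of_one_le₀ (one_le_pow₀ (by norm_num))
  have h1' : sideLen n ((j : ℤ), m) ≤ 1 := h1
  rw [volume_dCube, logRieszK, if_pos h1', sideLen, ← ENNReal.ofReal_mul' (by positivity)]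
  congr 1
  have : Real.log (C / 2 ^ (-(j:ℤ))) = Real.log C + j * Real.log 2 := by
    rw [Real.log_div hC.ne' hr.ne', Real.log_zpow]
    push_cast
    ring
  rw [this, aSeq, mul_inv]
  field_simp

lemma K_neg (n : ℕ) (β C : ℝ) (q : DIdx n) (hk : q.1 < 0) : logRieszK n β C q = 0 := by
  have : ¬ sideLen n q ≤ 1 := by
    rw [not_le, sideLen]
    exact one_lt_zpow₀ (by norm_num) (by omega)
  rw [logRieszK, if_neg this, ENNReal.ofReal_zero]

lemma tsum_ch (n : ℕ) (x : Euc n) (f : DIdx n → ℝ≥0∞) :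
    ∑' Q : DIdx n, f Q * ch n Q x = ∑' k : ℤ, f (idxAt n x k) := by
  rw [ENNReal.tsum_prod']
  refine tsum_congr fun k => ?_
  rw [tsum_eq_single (idxAt n x k).2]
  · change f (idxAt n x k) * ch n (idxAt n x k) x = _
    rw [ch, indicator_of_mem (mem_idxAt n x k)]
    simp
  · intro m hm
    rw [ch, indicator_of_notMem, mul_zero]
    intro h
    exact hm (congrArg Prod.snd ((mem_dCube_iff n x k m).1 h))

lemma idx_zero (n : ℕ) (x : Euc n) : x ∈ dCube n (unitIdx n) ↔ idxAt n x 0 = unitIdx n := by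
  rw [eq_comm]; exact mem_dCube_iff n x 0 _

lemma aSeq_summable (β C : ℝ) (hβ : 1 < β) (hC : 0 < Real.log C) : Summable (aSeq β C) := by
  have hs : Summable fun j : ℕ => ((Real.log 2) ^ β)⁻¹ * ((j : ℝ) ^ β)⁻¹ :=
    (Real.summable_nat_rpow_inv.2 hβ).mul_left _
  refine Summable.of_norm_bounded_eventually_nat hs ?_
  filter_upwards [Filter.eventually_gt_atTop 0] with j hj
  have hl : 0 < Real.log 2 := Real.log_pos (by norm_num)
  have hj' : (0:ℝ) < j := by exact_mod_cast hj
  have hp : 0 < Real.log C + j * Real.log 2 := by positivity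
  rw [aSeq, Real.norm_of_nonneg (by positivity), ← mul_inv, ← Real.mul_rpow hl.le hj'.le]
  refine inv_anti₀ (by positivity) (Real.rpow_le_rpow (by positivity) (by linarith) (by linarith))

/-- Tail sums. -/
def tailSum (β C : ℝ) (k : ℕ) : ℝ≥0∞ := ∑' d : ℕ, ENNReal.ofReal (aSeq β C (k + d))

lemma tail_lower (β C : ℝ) (hβ1 : 1 < β) (hβ2 : β ≤ 3/2) (hC : 0 < Real.log C) :
    ∃ c : ℝ, 0 < c ∧ ∀ k : ℕ, ENNReal.ofReal (c * (1 / ((k : ℝ) + 1))) ≤ tailSum β C k ^ 2 := by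
  have hl : 0 < Real.log 2 := Real.log_pos (by norm_num)
  set D := Real.log C + 2 * Real.log 2 with hD
  have hD0 : 0 < D := by positivity
  refine ⟨((D ^ β)⁻¹) ^ 2, by positivity, fun k => ?_⟩
  have hk : (0:ℝ) < (k:ℝ) + 1 := by positivity
  have hk0 : (0:ℝ) ≤ (k:ℝ) := by positivity
  have h1 : ∀ d ∈ Finset.range (k + 1),
      ((D * ((k:ℝ) + 1)) ^ β)⁻¹ ≤ aSeq β C (k + d) := by
    intro d hd
    have hd' : (d:ℝ) ≤ k := by
      exact_mod_cast Nat.lt_succ_iff.1 (Finset.mem_range.1 hd)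
    have hd0 : (0:ℝ) ≤ d := by positivity
    rw [aSeq]
    push_cast
    refine inv_anti₀ (by positivity) (Real.rpow_le_rpow (by positivity) ?_ (by linarith))
    rw [hD]
    nlinarith [mul_nonneg hk0 hC.le, mul_le_mul_of_nonneg_right hd' hl.le]
  have h2 : ENNReal.ofReal (((k:ℝ) + 1) * ((D * ((k:ℝ) + 1)) ^ β)⁻¹) ≤ tailSum β C k := by
    refine le_trans ?_ (ENNReal.sum_le_tsum (Finset.range (k + 1)))
    rw [← ENNReal.ofReal_sum_of_nonneg]
    · refine ENNReal.ofReal_le_ofReal ?_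
      have := Finset.card_nsmul_le_sum _ _ _ h1
      simpa using this
    · intro d hd
      exact le_trans (by positivity) (h1 d hd)
  refine le_trans ?_ (pow_le_pow_left' h2 2)
  rw [← ENNReal.ofReal_pow (by positivity)]
  refine ENNReal.ofReal_le_ofReal ?_
  rw [Real.mul_rpow hD0.le hk.le, mul_inv]
  have h3 : 1 / ((k:ℝ) + 1) ≤ (((k:ℝ) + 1) * (((k:ℝ) + 1) ^ β)⁻¹) ^ 2 := by
    have e : (((k:ℝ) + 1) ^ β) ^ 2 ≤ ((k:ℝ) + 1) ^ 3 := by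
      rw [← Real.rpow_natCast, ← Real.rpow_mul hk.le, ← Real.rpow_natCast]
      refine Real.rpow_le_rpow_of_exponent_le (by linarith) ?_
      push_cast
      linarith
    have hp : 0 < ((k:ℝ) + 1) ^ β := by positivity
    rw [mul_pow, inv_pow, ← div_eq_mul_inv, div_le_div_iff₀ hk (by positivity)]
    nlinarith
  calc _ ≤ (D ^ β)⁻¹ ^ 2 * (((k:ℝ) + 1) * (((k:ℝ) + 1) ^ β)⁻¹) ^ 2 := by gcongr
    _ = _ := by ring

lemma tail_sq_top (β C : ℝ) (hβ1 : 1 < β) (hβ2 : β ≤ 3/2) (hC : 0 < Real.log C) :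
    ∑' k : ℕ, tailSum β C k ^ 2 = ∞ := by
  obtain ⟨c, hc, h⟩ := tail_lower β C hβ1 hβ2 hC
  by_contra hne
  have h' : ∑' k : ℕ, ENNReal.ofReal (c * (1 / ((k : ℝ) + 1))) ≠ ∞ :=
    ne_top_of_le_ne_top hne (ENNReal.tsum_le_tsum h)
  have hs := ENNReal.summable_toReal h'
  have hs2 : Summable fun k : ℕ => c * (1 / ((k : ℝ) + 1)) := by
    refine hs.congr fun k => ?_
    rw [ENNReal.toReal_ofReal (by positivity)]
  have hs3 := (summable_mul_left_iff hc.ne').1 hs2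
  have hs4 : Summable fun k : ℕ => 1 / (((k + 1 : ℕ)) : ℝ) := by simpa using hs3
  exact Real.not_summable_one_div_natCast ((summable_nat_add_iff 1).1 hs4)

lemma Kbar_lower (n : ℕ) (β C : ℝ) (hC : 0 < C) (y : Euc n) (k : ℕ) :
    (volume (dCube n (idxAt n y k)))⁻¹ * tailSum β C k ≤
      Kbar n volume (logRieszK n β C) (idxAt n y k) y := by
  rw [Kbar]
  gcongr
  have hinj : Function.Injective fun d : ℕ => idxAt n y ((k:ℤ) + d) := by
    intro a b hab
    have := congrArg Prod.fst hab
    simp only [idxAt] at this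
    omega
  refine le_trans ?_ (ENNReal.tsum_comp_le_tsum_of_injective hinj _)
  refine ENNReal.tsum_le_tsum fun d => ?_
  rw [if_pos (idxAt_subset n y k d), ch, indicator_of_mem (mem_idxAt n y _)]
  have := K_mul_vol n β C hC (k + d) (idxAt n y ((k:ℤ) + d)).2
  rw [← this]
  push_cast
  simp [idxAt]

lemma vol_ne (n : ℕ) (q : DIdx n) : volume (dCube n q) ≠ 0 ∧ volume (dCube n q) ≠ ∞ := by
  obtain ⟨k, m⟩ := q
  rw [volume_dCube]
  refine ⟨?_, ENNReal.ofReal_ne_top⟩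
  have : (0:ℝ) < ((2:ℝ) ^ (-k)) ^ n := by positivity
  simpa using this

lemma W_top (n : ℕ) (β C : ℝ) (hβ1 : 1 < β) (hβ2 : β ≤ 3/2) (hC0 : 0 < C)
    (hC : 0 < Real.log C) (x : Euc n) (hx : x ∈ dCube n (unitIdx n)) :
    (∑' Q : DIdx n,
          volume (dCube n Q) * Kbar n volume (logRieszK n β C) Q x *
            ∫⁻ y in dCube n Q, Kbar n volume (logRieszK n β C) Q y
              ∂(volume.restrict (dCube n (unitIdx n)))) = ∞ := by
  rw [← top_le_iff, ← tail_sq_top β C hβ1 hβ2 hC]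
  have hinj : Function.Injective fun k : ℕ => idxAt n x (k:ℤ) := by
    intro a b hab
    have := congrArg Prod.fst hab
    simp only [idxAt] at this
    omega
  refine le_trans ?_ (ENNReal.tsum_comp_le_tsum_of_injective hinj _)
  refine ENNReal.tsum_le_tsum fun k => ?_
  have hv := vol_ne n (idxAt n x k)
  have hsub : dCube n (idxAt n x k) ⊆ dCube n (unitIdx n) := by
    have := idxAt_subset n x 0 k
    rwa [(idx_zero n x).1 hx, zero_add] at this
  rw [Measure.restrict_restrict (measurableSet_dCube n _), inter_eq_left.2 hsub]
  have hI : tailSum β C k ≤ ∫⁻ y in dCube n (idxAt n x k),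
      Kbar n volume (logRieszK n β C) (idxAt n x k) y := by
    calc tailSum β C k = ∫⁻ y in dCube n (idxAt n x k),
          (volume (dCube n (idxAt n x k)))⁻¹ * tailSum β C k := by
          rw [setLIntegral_const, mul_right_comm, ENNReal.inv_mul_cancel hv.1 hv.2, one_mul]
      _ ≤ _ := by
          refine setLIntegral_mono' (measurableSet_dCube n _) fun y hy => ?_
          have e : idxAt n x k = idxAt n y k := (mem_dCube_iff n y k _).1 hy
          rw [e]
          exact Kbar_lower n β C hC0 y k
  have hK : tailSum β C k ≤ volume (dCube n (idxAt n x k)) *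
      Kbar n volume (logRieszK n β C) (idxAt n x k) x := by
    calc tailSum β C k = volume (dCube n (idxAt n x k)) *
          ((volume (dCube n (idxAt n x k)))⁻¹ * tailSum β C k) := by
          rw [← mul_assoc, ENNReal.mul_inv_cancel hv.1 hv.2, one_mul]
      _ ≤ _ := by
          gcongr
          exact Kbar_lower n β C hC0 x k
  rw [pow_two]
  exact mul_le_mul' hK hI

lemma energy_pt (n : ℕ) (β C : ℝ) (hC0 : 0 < C) (x : Euc n) :
    (∑' Q : DIdx n,
        logRieszK n β C Q * (volume.restrict (dCube n (unitIdx n))) (dCube n Q) * ch n Q x) ≤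
      (dCube n (unitIdx n)).indicator (fun _ => ∑' j : ℕ, ENNReal.ofReal (aSeq β C j)) x := by
  rw [tsum_ch n x (fun Q => logRieszK n β C Q *
    (volume.restrict (dCube n (unitIdx n))) (dCube n Q))]
  have hinj : Function.Injective ((↑) : ℕ → ℤ) := Nat.cast_injective
  rw [← hinj.tsum_eq]
  · by_cases hx : x ∈ dCube n (unitIdx n)
    · rw [indicator_of_mem hx]
      refine ENNReal.tsum_le_tsum fun k => ?_
      rw [← K_mul_vol n β C hC0 k (idxAt n x k).2]
      exact mul_le_mul' le_rfl (Measure.restrict_apply_le _ _)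
    · rw [indicator_of_notMem hx, nonpos_iff_eq_zero, ENNReal.tsum_eq_zero]
      intro k
      rw [Measure.restrict_apply (measurableSet_dCube n _)]
      have : dCube n (idxAt n x k) ∩ dCube n (unitIdx n) = ∅ := by
        rw [eq_empty_iff_forall_notMem]
        rintro y ⟨hy1, hy2⟩
        have e : idxAt n x k = idxAt n y k := (mem_dCube_iff n y k _).1 hy1
        have h1 := idxAt_subset n y 0 k
        rw [zero_add, ← e, (idx_zero n y).1 hy2] at h1
        exact hx (h1 (mem_idxAt n x k))
      rw [this, measure_empty, mul_zero]
  · intro k hk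
    by_contra hr
    have : k < 0 := by
      by_contra h
      exact hr ⟨k.toNat, by simp; omega⟩
    refine hk ?_
    change logRieszK n β C (idxAt n x k) * _ = 0
    rw [K_neg n β C _ this, zero_mul]

/-- Let `n ≥ 1`, `1 < β ≤ 3/2`, `C ≥ e^{β/n}`, `k(r) = 1/(r^n log^β(C/r))`
for `0 < r ≤ 1`, `k(r) = 0` for `r > 1`, `K(Q) = k(r_Q)`, `σ` Lebesgue measure, and `μ`
Lebesgue measure restricted to the unit cube `Q₀`. Then for `p = 2` (so `p' = 2`):
(i) the dyadic energy `ℰ^𝒟_{K,σ}[μ] = ∫ (∑_Q K(Q) μ(Q) χ_Q(x))² dx` is finite, but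
(ii) `∫ 𝒲̄^𝒟_{K,σ}[μ] dμ = ∞`, where
`𝒲̄^𝒟_{K,σ}[μ](x) = ∑_Q σ(Q) K̄(Q)(x) ∫_Q K̄(Q)(y) dμ(y)`. -/
theorem stmt10 (n : ℕ) (hn : 0 < n) (β C : ℝ) (hβ1 : 1 < β) (hβ2 : β ≤ 3/2)
    (hC : Real.exp (β / n) ≤ C) :
    (∫⁻ x, (∑' Q : DIdx n,
        logRieszK n β C Q * (volume.restrict (dCube n (unitIdx n))) (dCube n Q) * ch n Q x) ^ 2
      ∂(volume : Measure (Euc n))) < ∞ ∧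
    (∫⁻ x, (∑' Q : DIdx n,
          volume (dCube n Q) * Kbar n volume (logRieszK n β C) Q x *
            ∫⁻ y in dCube n Q, Kbar n volume (logRieszK n β C) Q y
              ∂(volume.restrict (dCube n (unitIdx n))))
        ∂(volume.restrict (dCube n (unitIdx n)))) = ∞ := by
  have hC0 : 0 < C := lt_of_lt_of_le (Real.exp_pos _) hC
  have hL : 0 < Real.log C := by
    have h1 : β / n ≤ Real.log C := (Real.le_log_iff_exp_le hC0).2 hC
    have h2 : 0 < β / n := by
      have : (0:ℝ) < n := by exact_mod_cast hn
      have : 0 < β := by linarith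
      positivity
    linarith
  have hm := measurableSet_dCube n (unitIdx n)
  have hv := vol_ne n (unitIdx n)
  constructor
  · have hS : ∑' j : ℕ, ENNReal.ofReal (aSeq β C j) ≠ ∞ :=
      (aSeq_summable β C hβ1 hL).tsum_ofReal_ne_top
    calc _ ≤ ∫⁻ x, (dCube n (unitIdx n)).indicator
          (fun _ => (∑' j : ℕ, ENNReal.ofReal (aSeq β C j)) ^ 2) x := by
          refine lintegral_mono fun x => ?_
          refine (pow_le_pow_left' (energy_pt n β C hC0 x) 2).trans ?_
          by_cases hx : x ∈ dCube n (unitIdx n) <;> simp [hx]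
      _ < ∞ := by
          rw [lintegral_indicator_const hm]
          exact ENNReal.mul_lt_top (ENNReal.pow_lt_top hS.lt_top) hv.2.lt_top
  · rw [setLIntegral_congr_fun hm (fun x hx => W_top n β C hβ1 hβ2 hC0 hL x hx),
      setLIntegral_const, ENNReal.top_mul hv.1]
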